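/- Let K be a compact connected subset of ℝ². Then the function ε ↦ L(K^ε \ K)/ε − πε is non-increasing on (0,∞), where L denotes Lebesgue measure and K^ε = {x : dist(x,K) ≤ ε}. -/

import Mathlib

open Metric MeasureTheory Set

noncomputable abbrev Plane := EuclideanSpace ℝ (Fin 2)

/-- Euler characteristic inequality for a connected finite subcomplex of the square grid. -/
lemma grid_euler (V Eh Ev F : Finset (ℤ × ℤ))
    (hEh : ∀ e ∈ Eh, e ∈ V ∧ e + (0, 1) ∈ V)
    (hEv : ∀ e ∈ Ev, e ∈ V ∧ e + (1, 0) ∈ V)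
    (hF : ∀ f ∈ F, f ∈ Eh ∧ f + (1, 0) ∈ Eh ∧ f ∈ Ev ∧ f + (0, 1) ∈ Ev)
    (hconn : ∀ P : ℤ × ℤ → Prop, (∀ e ∈ Eh, P e ↔ P (e + (0, 1))) →
      (∀ e ∈ Ev, P e ↔ P (e + (1, 0))) → ∀ z ∈ V, ∀ w ∈ V, P z → P w) :
    V.card + F.card ≤ Eh.card + Ev.card + 1 := by
  classical
  rcases V.eq_empty_or_nonempty with hV | ⟨z0, hz0⟩
  · have : F = ∅ := by
      apply Finset.eq_empty_of_forall_notMem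
      intro f hf
      have := (hEh f (hF f hf).1).1
      simp [hV] at this
    simp [hV, this]
  let G : SimpleGraph {z // z ∈ V} := SimpleGraph.fromRel (fun a b =>
    (a.1 ∈ Ev ∧ b.1 = a.1 + (1, 0)) ∨ (a.1 ∈ Eh ∧ a.1 - (1, 0) ∉ F ∧ b.1 = a.1 + (0, 1)))
  have hadj1 : ∀ e (he : e ∈ Ev), G.Reachable ⟨e, (hEv e he).1⟩ ⟨e + (1, 0), (hEv e he).2⟩ := by
    intro e he
    apply SimpleGraph.Adj.reachable
    rw [SimpleGraph.fromRel_adj]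
    refine ⟨by simp [Subtype.ext_iff], Or.inl (Or.inl ⟨he, rfl⟩)⟩
  have hadj2 : ∀ e (he : e ∈ Eh), e - (1, 0) ∉ F →
      G.Reachable ⟨e, (hEh e he).1⟩ ⟨e + (0, 1), (hEh e he).2⟩ := by
    intro e he hf
    apply SimpleGraph.Adj.reachable
    rw [SimpleGraph.fromRel_adj]
    refine ⟨by simp [Subtype.ext_iff], Or.inl (Or.inr ⟨he, hf, rfl⟩)⟩
  obtain ⟨m, hm⟩ : ∃ m : ℤ, ∀ e ∈ Eh, m ≤ e.1 := by
    obtain ⟨m, hm⟩ := (Eh.image Prod.fst).bddBelow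
    exact ⟨m, fun e he => hm (by simpa using ⟨e.2, he⟩)⟩
  have key : ∀ n : ℕ, ∀ e (he : e ∈ Eh), e.1 < m + n →
      G.Reachable ⟨e, (hEh e he).1⟩ ⟨e + (0, 1), (hEh e he).2⟩ := by
    intro n
    induction n with
    | zero => intro e he h; have := hm e he; simp at h; omega
    | succ n ih =>
      intro e he h
      by_cases hf : e - (1, 0) ∈ F
      · obtain ⟨f, rfl⟩ : ∃ f, e = f + (1, 0) := ⟨e - (1, 0), by simp⟩
        simp only [add_sub_cancel_right] at hf
        obtain ⟨h1, h2, h3, h4⟩ := hF f hf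
        have r1 := ih f h1 (by simp at h; omega)
        have r2 := hadj1 f h3
        have r3 := hadj1 _ h4
        have := r2.symm.trans (r1.trans r3)
        convert this using 2
        abel
      · exact hadj2 e he hf
  have key' : ∀ e (he : e ∈ Eh), G.Reachable ⟨e, (hEh e he).1⟩ ⟨e + (0, 1), (hEh e he).2⟩ := by
    intro e he
    apply key (e.1 - m + 1).toNat e he
    have := hm e he
    omega
  have hG : G.Connected := by
    have : Nonempty {z // z ∈ V} := ⟨⟨z0, hz0⟩⟩
    refine SimpleGraph.Connected.mk ?_
    intro a b
    have := hconn (fun z => ∃ h : z ∈ V, G.Reachable a ⟨z, h⟩) ?_ ?_ a.1 a.2 b.1 b.2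
      ⟨a.2, SimpleGraph.Reachable.refl _⟩
    · exact this.2
    · intro e he
      exact ⟨fun ⟨h, r⟩ => ⟨(hEh e he).2, r.trans (key' e he)⟩,
        fun ⟨h, r⟩ => ⟨(hEh e he).1, r.trans (key' e he).symm⟩⟩
    · intro e he
      exact ⟨fun ⟨h, r⟩ => ⟨(hEv e he).2, r.trans (hadj1 e he)⟩,
        fun ⟨h, r⟩ => ⟨(hEv e he).1, r.trans (hadj1 e he).symm⟩⟩
  have h1 := hG.card_vert_le_card_edgeSet_add_one
  let T : Finset (Sym2 (ℤ × ℤ)) := Ev.image (fun e => s(e, e + (1, 0))) ∪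
    (Eh \ F.image (fun f => f + (1, 0))).image (fun e => s(e, e + (0, 1)))
  have h2 : Nat.card G.edgeSet ≤ T.card := by
    have : ∀ e : G.edgeSet, e.1.map Subtype.val ∈ T := by
      rintro ⟨e, he⟩
      induction e with
      | h a b =>
        rw [SimpleGraph.mem_edgeSet, SimpleGraph.fromRel_adj] at he
        simp only [T, Finset.mem_union, Finset.mem_image, Finset.mem_sdiff, Sym2.map_mk]
        rcases he with ⟨-, (⟨h1, h2⟩ | ⟨h1, h2, h3⟩) | (⟨h1, h2⟩ | ⟨h1, h2, h3⟩)⟩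
        · exact Or.inl ⟨a, h1, by rw [h2]⟩
        · refine Or.inr ⟨a, ⟨h1, ?_⟩, by rw [h3]⟩
          rintro ⟨f, hf, h⟩
          exact h2 (by rw [← h]; simpa using hf)
        · exact Or.inl ⟨b, h1, by rw [h2]; exact Sym2.eq_swap⟩
        · refine Or.inr ⟨b, ⟨h1, ?_⟩, by rw [h3]; exact Sym2.eq_swap⟩
          rintro ⟨f, hf, h⟩
          exact h2 (by rw [← h]; simpa using hf)
    have hinj : Function.Injective (fun e : G.edgeSet => (⟨e.1.map Subtype.val, this e⟩ : T)) := by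
      intro e f h
      simp only [Subtype.mk.injEq] at h
      exact Subtype.ext (Sym2.map.injective Subtype.val_injective h)
    have := Nat.card_le_card_of_injective _ hinj
    simpa using this
  have h3 : T.card ≤ Ev.card + (Eh.card - F.card) := by
    refine (Finset.card_union_le _ _).trans (add_le_add Finset.card_image_le ?_)
    refine Finset.card_image_le.trans ?_
    rw [Finset.card_sdiff_of_subset, Finset.card_image_of_injective _ (add_left_injective _)]
    intro x hx
    obtain ⟨f, hf, rfl⟩ := Finset.mem_image.1 hx
    exact (hF f hf).2.1
  have h4 : F.card ≤ Eh.card := Finset.card_le_card fun f hf => (hF f hf).1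
  have h5 : Nat.card {z // z ∈ V} = V.card := by simp
  omega
open scoped Pointwise

/-- The segment from `0` to `v`. -/
def seg (v : Plane) : Set Plane := (fun τ : ℝ => τ • v) '' Icc 0 1

lemma seg_compact (v : Plane) : IsCompact (seg v) :=
  isCompact_Icc.image (by fun_prop)

lemma seg_connected (v : Plane) : IsConnected (seg v) :=
  (isConnected_Icc zero_le_one).image _ (by fun_prop)

lemma seg_convex (v : Plane) : Convex ℝ (seg v) := by
  have := (convex_Icc (0:ℝ) 1).linear_image (LinearMap.toSpanSingleton ℝ Plane v)
  exact this

lemma image_seg (f : Plane →ₗ[ℝ] Plane) (v : Plane) : f '' seg v = seg (f v) := by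
  unfold seg
  rw [image_image]
  simp

/-- First basis vector. -/
def e0 : Plane := !₂[1, 0]
/-- Second basis vector. -/
def e1 : Plane := !₂[0, 1]
/-- Lattice points. -/
def emb (z : ℤ × ℤ) : Plane := !₂[(z.1 : ℝ), (z.2 : ℝ)]

lemma plane_ext {p q : Plane} (h0 : p 0 = q 0) (h1 : p 1 = q 1) : p = q := by
  ext i; fin_cases i <;> assumption

@[simp] lemma emb_0 (z) : emb z 0 = z.1 := rfl
@[simp] lemma emb_1 (z) : emb z 1 = z.2 := rfl
@[simp] lemma e0_0 : e0 0 = 1 := rfl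
@[simp] lemma e0_1 : e0 1 = 0 := rfl
@[simp] lemma e1_0 : e1 0 = 0 := rfl
@[simp] lemma e1_1 : e1 1 = 1 := rfl

lemma mem_add_seg0 (A : Set Plane) (p : Plane) :
    p ∈ A + seg e0 ↔ ∃ a ∈ A, a 0 ≤ p 0 ∧ p 0 ≤ a 0 + 1 ∧ p 1 = a 1 := by
  constructor
  · rintro ⟨a, ha, _, ⟨τ, ⟨h1, h2⟩, rfl⟩, rfl⟩
    exact ⟨a, ha, by simpa using h1, by simpa using h2, by simp⟩
  · rintro ⟨a, ha, h1, h2, h3⟩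
    refine ⟨a, ha, _, ⟨p 0 - a 0, ⟨by linarith, by linarith⟩, rfl⟩, ?_⟩
    apply plane_ext <;> simp [h3]

lemma mem_add_seg1 (A : Set Plane) (p : Plane) :
    p ∈ A + seg e1 ↔ ∃ a ∈ A, a 1 ≤ p 1 ∧ p 1 ≤ a 1 + 1 ∧ p 0 = a 0 := by
  constructor
  · rintro ⟨a, ha, _, ⟨τ, ⟨h1, h2⟩, rfl⟩, rfl⟩
    exact ⟨a, ha, by simpa using h1, by simpa using h2, by simp⟩
  · rintro ⟨a, ha, h1, h2, h3⟩
    refine ⟨a, ha, _, ⟨p 1 - a 1, ⟨by linarith, by linarith⟩, rfl⟩, ?_⟩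
    apply plane_ext <;> simp [h3]

lemma mem_add_seg01 (A : Set Plane) (p : Plane) :
    p ∈ A + seg e0 + seg e1 ↔ ∃ a ∈ A, a 0 ≤ p 0 ∧ p 0 ≤ a 0 + 1 ∧ a 1 ≤ p 1 ∧ p 1 ≤ a 1 + 1 := by
  rw [mem_add_seg1]
  constructor
  · rintro ⟨b, hb, h⟩
    obtain ⟨a, ha, h'⟩ := (mem_add_seg0 A b).1 hb
    refine ⟨a, ha, ?_⟩
    rw [h.2.2, ← h'.2.2]
    exact ⟨h'.1, h'.2.1, h.1, h.2.1⟩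
  · rintro ⟨a, ha, h⟩
    refine ⟨!₂[p 0, a 1], (mem_add_seg0 _ _).2 ⟨a, ha, ?_⟩, ?_⟩
    · simp [h.1, h.2.1]
    · simp [h.2.2.1, h.2.2.2]

lemma finite_lattice (X : Set Plane) (hX : IsCompact X) (x : Plane) :
    {z : ℤ × ℤ | x + emb z ∈ X}.Finite := by
  obtain ⟨M, hM⟩ := hX.isBounded.exists_norm_le
  obtain ⟨N, hN⟩ := exists_nat_ge (M + ‖x‖)
  apply ((finite_Icc (-(N:ℤ)) N).prod (finite_Icc (-(N:ℤ)) N)).subset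
  intro z hz
  have h1 := hM _ hz
  have h2 : ‖emb z‖ ≤ N := by
    have : emb z = (x + emb z) - x := by abel
    rw [this]
    exact (norm_sub_le _ _).trans (by linarith)
  have h3 := (PiLp.norm_apply_le (emb z) 0).trans h2
  have h4 := (PiLp.norm_apply_le (emb z) 1).trans h2
  simp only [emb_0, emb_1, Real.norm_eq_abs, abs_le] at h3 h4
  refine ⟨⟨?_, ?_⟩, ?_, ?_⟩
  · exact_mod_cast h3.1
  · exact_mod_cast h3.2
  · exact_mod_cast h4.1
  · exact_mod_cast h4.2

lemma lattice_count (A : Set Plane) (hc : IsConnected A) (x : Plane)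
    (V Eh Ev F : Finset (ℤ × ℤ)) (hV : ∀ z, z ∈ V ↔ x + emb z ∈ A + seg e0 + seg e1)
    (hEh : ∀ z, z ∈ Eh ↔ x + emb z ∈ A + seg e0)
    (hEv : ∀ z, z ∈ Ev ↔ x + emb z ∈ A + seg e1)
    (hF : ∀ z, z ∈ F ↔ x + emb z ∈ A) :
    V.card + F.card ≤ Eh.card + Ev.card + 1 := by
  simp only [mem_add_seg01] at hV
  simp only [mem_add_seg0, mem_add_seg1] at hEh hEv
  simp only [PiLp.add_apply, emb_0, emb_1] at hV hEh hEv
  have f1 : ∀ e ∈ Eh, e ∈ V ∧ e + (0, 1) ∈ V := by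
    intro e he
    obtain ⟨a, ha, h1, h2, h3⟩ := (hEh e).1 he
    refine ⟨(hV _).2 ⟨a, ha, ?_⟩, (hV _).2 ⟨a, ha, ?_⟩⟩
    · refine ⟨?_, ?_, ?_, ?_⟩ <;> linarith
    · refine ⟨?_, ?_, ?_, ?_⟩ <;> push_cast [Prod.fst_add, Prod.snd_add] <;> linarith
  have f2 : ∀ e ∈ Ev, e ∈ V ∧ e + (1, 0) ∈ V := by
    intro e he
    obtain ⟨a, ha, h1, h2, h3⟩ := (hEv e).1 he
    refine ⟨(hV _).2 ⟨a, ha, ?_⟩, (hV _).2 ⟨a, ha, ?_⟩⟩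
    · refine ⟨?_, ?_, ?_, ?_⟩ <;> linarith
    · refine ⟨?_, ?_, ?_, ?_⟩ <;> push_cast [Prod.fst_add, Prod.snd_add] <;> linarith
  have f3 : ∀ f ∈ F, f ∈ Eh ∧ f + (1, 0) ∈ Eh ∧ f ∈ Ev ∧ f + (0, 1) ∈ Ev := by
    intro f hf
    have hf := (hF f).1 hf
    refine ⟨(hEh _).2 ⟨_, hf, ?_⟩, (hEh _).2 ⟨_, hf, ?_⟩, (hEv _).2 ⟨_, hf, ?_⟩,
      (hEv _).2 ⟨_, hf, ?_⟩⟩ <;> simp [add_assoc]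
  refine grid_euler V Eh Ev F f1 f2 f3 ?_
  intro P hPh hPv
  -- canonical cell of a point
  let c : Plane → ℤ × ℤ := fun a => (⌈a 0 - x 0⌉, ⌈a 1 - x 1⌉)
  let Cell : ℤ × ℤ → Set Plane := fun z => {a | a 0 ≤ x 0 + z.1 ∧ x 0 + z.1 ≤ a 0 + 1 ∧
    a 1 ≤ x 1 + z.2 ∧ x 1 + z.2 ≤ a 1 + 1}
  have hcell : ∀ a, a ∈ Cell (c a) := by
    intro a
    have h0 := Int.le_ceil (a 0 - x 0)
    have h1 := Int.le_ceil (a 1 - x 1)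
    have h2 := (Int.ceil_lt_add_one (a 0 - x 0)).le
    have h3 := (Int.ceil_lt_add_one (a 1 - x 1)).le
    refine ⟨?_, ?_, ?_, ?_⟩ <;> simp only [c] <;> linarith
  have hcV : ∀ a ∈ A, c a ∈ V := fun a ha => (hV _).2 ⟨a, ha, hcell a⟩
  have aux : ∀ (t : ℝ) (m : ℤ), t ≤ m → (m:ℝ) ≤ t + 1 → m = ⌈t⌉ ∨ (m = ⌈t⌉ + 1 ∧ t = ⌈t⌉) := by
    intro t m h1 h2
    have h3 : ⌈t⌉ ≤ m := Int.ceil_le.2 h1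
    have h4 := Int.le_ceil t
    have h5 : m < ⌈t⌉ + 2 := by
      have := Int.ceil_lt_add_one t
      have : (m:ℝ) < ⌈t⌉ + 2 := by linarith
      exact_mod_cast this
    rcases h3.eq_or_lt with h | h
    · exact Or.inl h.symm
    · have h6 : m = ⌈t⌉ + 1 := by omega
      refine Or.inr ⟨h6, le_antisymm h4 ?_⟩
      rw [h6] at h2
      push_cast at h2
      linarith
  have hcanon : ∀ a ∈ A, ∀ z, a ∈ Cell z → (P z ↔ P (c a)) := by
    rintro a ha z ⟨h1, h2, h3, h4⟩
    have k0 := Int.le_ceil (a 0 - x 0)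
    have k1 := Int.le_ceil (a 1 - x 1)
    have k2 := (Int.ceil_lt_add_one (a 0 - x 0)).le
    have k3 := (Int.ceil_lt_add_one (a 1 - x 1)).le
    rcases aux (a 0 - x 0) z.1 (by linarith) (by linarith) with g0 | ⟨g0, g0'⟩ <;>
    rcases aux (a 1 - x 1) z.2 (by linarith) (by linarith) with g1 | ⟨g1, g1'⟩
    · have : z = c a := Prod.ext g0 g1
      rw [this]
    · have : z = c a + (0, 1) := Prod.ext (by simp [c, g0]) (by simp [c, g1])
      rw [this]
      refine (hPh _ ((hEh _).2 ⟨a, ha, ?_⟩)).symm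
      refine ⟨?_, ?_, ?_⟩ <;> simp only [c] <;> linarith
    · have : z = c a + (1, 0) := Prod.ext (by simp [c, g0]) (by simp [c, g1])
      rw [this]
      refine (hPv _ ((hEv _).2 ⟨a, ha, ?_⟩)).symm
      refine ⟨?_, ?_, ?_⟩ <;> simp only [c] <;> linarith
    · have hz : z = c a + (1, 0) + (0, 1) := Prod.ext (by simp [c, g0]) (by simp [c, g1])
      have : c a ∈ F := by
        rw [hF]
        convert ha
        apply plane_ext <;> simp only [PiLp.add_apply, emb_0, emb_1, c] <;> linarith
      obtain ⟨q1, q2, q3, q4⟩ := f3 _ this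
      rw [hz, ← hPh _ q2, ← hPv _ q3]
  have hclosed : ∀ z, IsClosed (Cell z) := by
    intro z
    have c0 : Continuous fun a : Plane => a 0 := by fun_prop
    have c1 : Continuous fun a : Plane => a 1 := by fun_prop
    refine (isClosed_le c0 continuous_const).inter ((isClosed_le continuous_const
      (c0.add continuous_const)).inter ((isClosed_le c1 continuous_const).inter
      (isClosed_le continuous_const (c1.add continuous_const))))
  intro z hz w hw hPz
  by_contra hPw
  have hpre := isPreconnected_closed_iff.1 hc.isPreconnected
    (⋃ z ∈ {z | z ∈ V ∧ P z}, Cell z) (⋃ z ∈ {z | z ∈ V ∧ ¬ P z}, Cell z)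
    ((V.finite_toSet.subset fun z h => h.1).isClosed_biUnion fun z _ => hclosed z)
    ((V.finite_toSet.subset fun z h => h.1).isClosed_biUnion fun z _ => hclosed z) ?_ ?_ ?_
  · obtain ⟨a, ha, h1, h2⟩ := hpre
    simp only [mem_iUnion] at h1 h2
    obtain ⟨z1, hz1, h1⟩ := h1
    obtain ⟨z2, hz2, h2⟩ := h2
    exact hz2.2 (((hcanon a ha z2 h2).trans (hcanon a ha z1 h1).symm).2 hz1.2)
  · intro a ha
    by_cases h : P (c a)
    · exact Or.inl (mem_biUnion ⟨hcV a ha, h⟩ (hcell a))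
    · exact Or.inr (mem_biUnion ⟨hcV a ha, h⟩ (hcell a))
  · obtain ⟨a, ha, h⟩ := (hV z).1 hz
    exact ⟨a, ha, mem_biUnion (x := z) ⟨hz, hPz⟩ h⟩
  · obtain ⟨a, ha, h⟩ := (hV w).1 hw
    exact ⟨a, ha, mem_biUnion (x := w) ⟨hw, hPw⟩ h⟩

/-- The half-open unit square. -/
def cube : Set Plane := {x | x 0 ∈ Ico (0:ℝ) 1 ∧ x 1 ∈ Ico (0:ℝ) 1}

lemma cube_meas : MeasurableSet cube := by
  have c0 : Measurable fun a : Plane => a 0 := by fun_prop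
  have c1 : Measurable fun a : Plane => a 1 := by fun_prop
  exact (c0 measurableSet_Ico).inter (c1 measurableSet_Ico)

lemma cube_vol : volume cube = 1 := by
  have h : cube = (MeasurableEquiv.toLp 2 (Fin 2 → ℝ)).symm ⁻¹' (Set.pi univ fun _ => Ico (0:ℝ) 1) := by
    ext x
    simp [cube, Fin.forall_fin_two]
  rw [h, (EuclideanSpace.volume_preserving_symm_measurableEquiv_toLp (Fin 2)).measure_preimage
    (MeasurableSet.univ_pi fun _ => measurableSet_Ico).nullMeasurableSet]
  simp [Real.volume_pi_Ico]

lemma vol_eq_lintegral (X : Set Plane) (hX : MeasurableSet X) :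
    volume X = ∫⁻ x in cube, ∑' z : ℤ × ℤ, X.indicator 1 (x + emb z) := by
  have hm : ∀ z : ℤ × ℤ, Measurable fun x : Plane => X.indicator (1 : Plane → ENNReal) (x + emb z) :=
    fun z => (measurable_one.indicator hX).comp (measurable_id.add_const _)
  rw [lintegral_tsum (fun z => (hm z).aemeasurable)]
  have hU : X = ⋃ z : ℤ × ℤ, X ∩ ((fun x => x + - emb z) ⁻¹' cube) := by
    rw [← inter_iUnion]
    refine (inter_eq_left.2 ?_).symm
    intro x _
    refine mem_iUnion.2 ⟨(⌊x 0⌋, ⌊x 1⌋), ?_⟩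
    have h0 := Int.floor_le (x 0)
    have h1 := Int.floor_le (x 1)
    have h2 := Int.lt_floor_add_one (x 0)
    have h3 := Int.lt_floor_add_one (x 1)
    refine ⟨⟨?_, ?_⟩, ?_, ?_⟩ <;> simp <;> linarith
  conv_lhs => rw [hU]
  rw [measure_iUnion]
  · congr 1
    ext z
    have h1 : X ∩ ((fun x => x + - emb z) ⁻¹' cube) =
        (fun x => x + - emb z) ⁻¹' ((fun x => x + emb z) ⁻¹' X ∩ cube) := by
      ext x; simp
    have h2 : (fun x : Plane => X.indicator (1 : Plane → ENNReal) (x + emb z)) =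
        ((fun x => x + emb z) ⁻¹' X).indicator 1 := by
      rfl
    have h3 : MeasurableSet ((fun x => x + emb z) ⁻¹' X) := (measurable_id.add_const (emb z)) hX
    rw [h1, measure_preimage_add_right, h2, lintegral_indicator_one h3, Measure.restrict_apply h3]
  · intro z w hzw
    rw [Function.onFun, Set.disjoint_left]
    rintro x ⟨_, ⟨⟨h1, h2⟩, h3, h4⟩⟩ ⟨_, ⟨⟨g1, g2⟩, g3, g4⟩⟩
    apply hzw
    simp at h1 h2 h3 h4 g1 g2 g3 g4
    have a1 : ⌊x 0⌋ = z.1 := Int.floor_eq_iff.2 ⟨h1, by linarith⟩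
    have a2 : ⌊x 1⌋ = z.2 := Int.floor_eq_iff.2 ⟨h3, by linarith⟩
    have a3 : ⌊x 0⌋ = w.1 := Int.floor_eq_iff.2 ⟨g1, by linarith⟩
    have a4 : ⌊x 1⌋ = w.2 := Int.floor_eq_iff.2 ⟨g3, by linarith⟩
    exact Prod.ext (a1.symm.trans a3) (a2.symm.trans a4)
  · intro z
    exact hX.inter ((measurable_id.add_const _) cube_meas)

lemma unit_ineq (A : Set Plane) (hA : IsCompact A) (hc : IsConnected A) :
    volume (A + seg e0 + seg e1) + volume A ≤
      volume (A + seg e0) + volume (A + seg e1) + 1 := by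
  have k10 := hA.add (seg_compact e0)
  have k01 := hA.add (seg_compact e1)
  have k11 := k10.add (seg_compact e1)
  have hm : ∀ X : Set Plane, IsCompact X →
      Measurable fun x : Plane => ∑' z : ℤ × ℤ, X.indicator (1 : Plane → ENNReal) (x + emb z) :=
    fun X hX => Measurable.tsum
      fun z => (measurable_one.indicator hX.measurableSet).comp (measurable_id.add_const _)
  rw [vol_eq_lintegral _ hA.measurableSet, vol_eq_lintegral _ k10.measurableSet,
    vol_eq_lintegral _ k01.measurableSet, vol_eq_lintegral _ k11.measurableSet]
  have h1 : (1 : ENNReal) = ∫⁻ x in cube, 1 := by simp [cube_vol]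
  rw [h1, ← lintegral_add_left (hm _ k11), ← lintegral_add_left (hm _ k10),
    ← lintegral_add_right _ measurable_const]
  apply lintegral_mono
  intro x
  have hs : ∀ X : Set Plane, ∀ hX : IsCompact X, ∑' z : ℤ × ℤ,
      X.indicator (1 : Plane → ENNReal) (x + emb z) = ((finite_lattice X hX x).toFinset.card : ENNReal) := by
    intro X hX
    rw [tsum_eq_sum (s := (finite_lattice X hX x).toFinset)]
    · rw [Finset.sum_congr rfl (g := fun _ => (1 : ENNReal))]
      · simp
      · intro z hz
        have : x + emb z ∈ X := by simpa using hz
        simp [this]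
    · intro z hz
      have : x + emb z ∉ X := by simpa using hz
      simp [this]
  simp only [hs _ hA, hs _ k10, hs _ k01, hs _ k11]
  have := lattice_count A hc x (finite_lattice _ k11 x).toFinset (finite_lattice _ k10 x).toFinset
    (finite_lattice _ k01 x).toFinset (finite_lattice _ hA x).toFinset
    (by simp) (by simp) (by simp) (by simp)
  exact_mod_cast this

/-- Area as a real number. -/
noncomputable def area (X : Set Plane) : ℝ := (volume X).toReal

/-- Determinant of two vectors. -/
def det2 (s t : Plane) : ℝ := s 0 * t 1 - s 1 * t 0

lemma area_mono {X Y : Set Plane} (hY : IsCompact Y) (h : X ⊆ Y) : area X ≤ area Y :=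
  ENNReal.toReal_mono hY.measure_ne_top (measure_mono h)

lemma para_ineq (A : Set Plane) (hA : IsCompact A) (hc : IsConnected A) (s t : Plane)
    (hst : det2 s t ≠ 0) :
    area (A + seg s + seg t) + area A ≤ area (A + seg s) + area (A + seg t) + |det2 s t| := by
  let M : Matrix (Fin 2) (Fin 2) ℝ := !![s 0, t 0; s 1, t 1]
  let L : Plane →ₗ[ℝ] Plane := Matrix.toEuclideanLin M
  have hdet : LinearMap.det L = det2 s t := by
    simp only [L, Matrix.toLpLin_eq_toLin, LinearMap.det_toLin]
    simp [M, Matrix.det_fin_two, det2]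
    ring
  have hL0 : L e0 = s := by
    apply plane_ext <;> simp [L, M, e0]
  have hL1 : L e1 = t := by
    apply plane_ext <;> simp [L, M, e1]
  let f : Plane ≃ₗ[ℝ] Plane := LinearEquiv.ofIsUnitDet (f := L)
    (v := (EuclideanSpace.basisFun (Fin 2) ℝ).toBasis)
    (v' := (EuclideanSpace.basisFun (Fin 2) ℝ).toBasis) (by
      rw [LinearMap.det_toMatrix, hdet]; exact isUnit_iff_ne_zero.2 hst)
  have hf : ∀ x, f x = L x := fun x => rfl
  let A' := f.symm '' A
  have hcont : Continuous f.symm := f.symm.toLinearMap.continuous_of_finiteDimensional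
  have hA' : IsCompact A' := hA.image hcont
  have hc' : IsConnected A' := hc.image _ hcont.continuousOn
  have hLA : L '' A' = A := by
    simp only [A', image_image]
    have : ∀ x, L (f.symm x) = x := fun x => by rw [← hf]; simp
    simp [this]
  have h := unit_ineq A' hA' hc'
  have h10 : L '' (A' + seg e0) = A + seg s := by
    rw [Set.image_add, hLA, image_seg, hL0]
  have h01 : L '' (A' + seg e1) = A + seg t := by
    rw [Set.image_add, hLA, image_seg, hL1]
  have h11 : L '' (A' + seg e0 + seg e1) = A + seg s + seg t := by
    rw [Set.image_add, h10, image_seg, hL1]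
  have k10 := hA'.add (seg_compact e0)
  have k01 := hA'.add (seg_compact e1)
  have k11 := k10.add (seg_compact e1)
  have hr : area (A' + seg e0 + seg e1) + area A' ≤
      area (A' + seg e0) + area (A' + seg e1) + 1 := by
    have n1 := hA'.measure_ne_top (μ := volume)
    have n2 := k10.measure_ne_top (μ := volume)
    have n3 := k01.measure_ne_top (μ := volume)
    have n4 := k11.measure_ne_top (μ := volume)
    have := ENNReal.toReal_mono (by simp [n2, n3]) h
    rw [ENNReal.toReal_add n4 n1, ENNReal.toReal_add (by simp [n2, n3]) (by simp),
      ENNReal.toReal_add n2 n3] at this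
    simpa [area] using this
  have hs : ∀ X, area (L '' X) = |det2 s t| * area X := by
    intro X
    unfold area
    rw [Measure.addHaar_image_linearMap, hdet, ENNReal.toReal_mul, ENNReal.toReal_ofReal (abs_nonneg _)]
  have hAr : area A = |det2 s t| * area A' := by rw [← hs, hLA]
  rw [← h11, ← h10, ← h01, hAr]
  simp only [hs]
  nlinarith [abs_nonneg (det2 s t), mul_le_mul_of_nonneg_left hr (abs_nonneg (det2 s t))]

lemma conn_add {A B : Set Plane} (hA : IsConnected A) (hB : IsConnected B) :
    IsConnected (A + B) := by
  rw [← Set.add_image_prod]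
  exact (hA.prod hB).image _ (by fun_prop)

/-- Minkowski sum of the segments of a list. -/
def zon (l : List Plane) : Set Plane := (l.map seg).sum

lemma zon_nil : zon [] = 0 := rfl
lemma zon_cons (v : Plane) (l : List Plane) : zon (v :: l) = seg v + zon l := by simp [zon]

lemma zon_compact (l : List Plane) : IsCompact (zon l) := by
  induction l with
  | nil => simp [zon_nil]
  | cons v l ih => rw [zon_cons]; exact (seg_compact v).add ih

lemma zon_convex (l : List Plane) : Convex ℝ (zon l) := by
  induction l with
  | nil => rw [zon_nil]; exact convex_singleton 0
  | cons v l ih => rw [zon_cons]; exact (seg_convex v).add ih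

lemma zon_ineq1 (s : Plane) (l : List Plane) (hl : ∀ t ∈ l, det2 s t ≠ 0) :
    ∀ (A : Set Plane) (_ : IsCompact A) (_ : IsConnected A),
    area (A + seg s + zon l) + area A ≤ area (A + seg s) + area (A + zon l) +
      (l.map fun t => |det2 s t|).sum := by
  induction l with
  | nil => intro A _ _; simp [zon_nil]
  | cons t l ih =>
    intro A hA hc
    have h1 := ih (fun t ht => hl t (by simp [ht])) (A + seg t) (hA.add (seg_compact t))
      (conn_add hc (seg_connected t))
    have h2 := para_ineq A hA hc s t (hl t (by simp))
    have h3 : A + seg s + zon (t :: l) = A + seg t + seg s + zon l := by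
      rw [zon_cons]; abel
    have h4 : A + zon (t :: l) = A + seg t + zon l := by
      rw [zon_cons]; abel
    have h5 : A + seg t + seg s = A + seg s + seg t := by abel
    rw [h3, h4]
    rw [h5] at h1 ⊢
    simp only [List.map_cons, List.sum_cons]
    linarith

lemma zon_ineq (k l : List Plane) (hl : ∀ s ∈ k, ∀ t ∈ l, det2 s t ≠ 0) :
    ∀ (A : Set Plane) (_ : IsCompact A) (_ : IsConnected A),
    area (A + zon k + zon l) + area A ≤ area (A + zon k) + area (A + zon l) +
      (k.map fun s => (l.map fun t => |det2 s t|).sum).sum := by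
  induction k with
  | nil => intro A _ _; simp [zon_nil]; linarith
  | cons s k ih =>
    intro A hA hc
    have h1 := ih (fun s hs => hl s (by simp [hs])) (A + seg s) (hA.add (seg_compact s))
      (conn_add hc (seg_connected s))
    have h2 := zon_ineq1 s l (hl s (by simp)) A hA hc
    have h4 : A + zon (s :: k) = A + seg s + zon k := by
      rw [zon_cons]; abel
    rw [h4]
    simp only [List.map_cons, List.sum_cons]
    linarith

lemma integral_abs_cos (a : ℝ) : ∫ τ in a..(a + Real.pi), |Real.cos τ| = 2 := by
  have hper : Function.Periodic (fun τ => |Real.cos τ|) Real.pi := by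
    intro τ; simp [Real.cos_add_pi]
  have h := hper.intervalIntegral_add_eq a (-(Real.pi / 2))
  rw [h]
  have e : -(Real.pi / 2) + Real.pi = Real.pi / 2 := by ring
  rw [e, intervalIntegral.integral_congr (g := Real.cos)]
  · rw [integral_cos]; simp; norm_num
  · intro τ hτ
    rw [uIcc_of_le (by linarith [Real.pi_pos])] at hτ
    exact abs_of_nonneg (Real.cos_nonneg_of_mem_Icc hτ)

lemma riemann (a : ℝ) (n : ℕ) (hn : 0 < n) :
    |Real.pi / n * ∑ k ∈ Finset.range n, |Real.cos (a + Real.pi * k / n)| - 2| ≤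
      Real.pi ^ 2 / n := by
  have hn' : (0:ℝ) < n := by exact_mod_cast hn
  let x : ℕ → ℝ := fun k => a + Real.pi * k / n
  have hx : ∀ k, x (k+1) - x k = Real.pi / n := by
    intro k; simp only [x]; push_cast; field_simp; ring
  have hstep : 0 < Real.pi / n := by positivity
  have hInt : ∀ u v : ℝ, IntervalIntegrable (fun τ => |Real.cos τ|) volume u v :=
    fun u v => (Real.continuous_cos.abs).intervalIntegrable u v
  have h1 := intervalIntegral.sum_integral_adjacent_intervals (μ := volume) (a := x) (n := n)
    (f := fun τ => |Real.cos τ|) (fun k _ => hInt _ _)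
  have e0 : x 0 = a := by simp [x]
  have en : x n = a + Real.pi := by simp only [x]; field_simp
  rw [e0, en, integral_abs_cos] at h1
  rw [← h1, Finset.mul_sum, ← Finset.sum_sub_distrib]
  refine (Finset.abs_sum_le_sum_abs _ _).trans ?_
  have h2 : ∀ k ∈ Finset.range n, |Real.pi / n * |Real.cos (a + Real.pi * k / n)| -
      (∫ τ in x k..x (k+1), |(Real.cos τ)|)| ≤ Real.pi / n * (Real.pi / n) := by
    intro k _
    have h3 : Real.pi / n * |Real.cos (a + Real.pi * k / n)| =
        ∫ τ in x k..x (k+1), |Real.cos (x k)| := by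
      rw [intervalIntegral.integral_const, hx]; simp [x]
    rw [h3, ← intervalIntegral.integral_sub (by simp) (hInt _ _)]
    have := intervalIntegral.norm_integral_le_of_norm_le_const (a := x k) (b := x (k+1))
      (C := Real.pi / n) (f := fun τ => |Real.cos (x k)| - |Real.cos τ|) ?_
    · rw [hx, abs_of_pos hstep] at this
      exact this
    · intro τ hτ
      rw [uIoc_of_le (by linarith [hx k])] at hτ
      rw [Real.norm_eq_abs]
      refine (abs_abs_sub_abs_le_abs_sub _ _).trans ((Real.abs_cos_sub_cos_le _ _).trans ?_)
      rw [abs_le]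
      constructor <;> linarith [hτ.1, hτ.2, hx k]
  refine (Finset.sum_le_sum h2).trans ?_
  simp only [Finset.sum_const, Finset.card_range, nsmul_eq_mul]
  apply le_of_eq
  field_simp

lemma zon_upper (l : List Plane) (w : Plane) : ∀ z ∈ zon l,
    inner ℝ w z - inner ℝ w l.sum / 2 ≤ (l.map fun v => |inner ℝ w v|).sum / 2 := by
  induction l with
  | nil => intro z hz; rw [zon_nil] at hz; simp [Set.mem_zero.1 hz]
  | cons v l ih =>
    intro z hz
    rw [zon_cons] at hz
    obtain ⟨_, ⟨τ, ⟨h0, h1⟩, rfl⟩, y, hy, rfl⟩ := hz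
    have := ih y hy
    simp only [List.sum_cons, List.map_cons, inner_add_right, inner_smul_right]
    have k1 := le_abs_self (inner ℝ w v)
    have k2 := neg_abs_le (inner ℝ w v)
    nlinarith [mul_nonneg h0 (sub_nonneg.2 k1), mul_nonneg (sub_nonneg.2 h1) (sub_nonneg.2 k2)]

lemma zon_lower (l : List Plane) (w : Plane) : ∃ z ∈ zon l,
    inner ℝ w z - inner ℝ w l.sum / 2 = - ((l.map fun v => |inner ℝ w v|).sum / 2) := by
  induction l with
  | nil => exact ⟨0, by simp [zon_nil], by simp⟩
  | cons v l ih =>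
    obtain ⟨y, hy, h⟩ := ih
    rw [zon_cons]
    rcases le_total 0 (inner ℝ w v) with hv | hv
    · refine ⟨0 + y, ⟨0, ⟨0, by simp, by simp⟩, y, hy, rfl⟩, ?_⟩
      simp only [List.sum_cons, List.map_cons, inner_add_right, abs_of_nonneg hv, inner_zero_right]
      linarith
    · refine ⟨v + y, ⟨v, ⟨1, by simp, by simp⟩, y, hy, rfl⟩, ?_⟩
      simp only [List.sum_cons, List.map_cons, inner_add_right, abs_of_nonpos hv]
      linarith

lemma zon_subset_ball (l : List Plane) (R : ℝ)
    (h : ∀ w : Plane, (l.map fun v => |inner ℝ w v|).sum / 2 ≤ R * ‖w‖) :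
    zon l ⊆ closedBall ((1/2 : ℝ) • l.sum) R := by
  intro z hz
  rw [mem_closedBall, dist_eq_norm]
  set w := z - (1/2 : ℝ) • l.sum with hw
  have h1 := zon_upper l w z hz
  have h2 : inner ℝ w z - inner ℝ w l.sum / 2 = ‖w‖ * ‖w‖ := by
    rw [← real_inner_self_eq_norm_mul_norm]
    nth_rewrite 4 [hw]
    rw [inner_sub_right, inner_smul_right]
    ring
  have h3 := h w
  rcases (norm_nonneg w).eq_or_lt with h4 | h4
  · have := h e0
    have h5 : 0 ≤ (l.map fun v => |inner ℝ e0 v|).sum := by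
      apply List.sum_nonneg
      intro x hx
      obtain ⟨v, _, rfl⟩ := List.mem_map.1 hx
      exact abs_nonneg _
    have h6 : 0 < ‖e0‖ := norm_pos_iff.2 (fun h => by simpa using congrArg (fun x : Plane => x 0) h)
    rw [← h4]
    by_contra hR
    push Not at hR
    nlinarith
  · exact le_of_mul_le_mul_right (by linarith) h4

lemma ball_subset_zon (l : List Plane) (r : ℝ)
    (h : ∀ w : Plane, r * ‖w‖ ≤ (l.map fun v => |inner ℝ w v|).sum / 2) :
    closedBall ((1/2 : ℝ) • l.sum) r ⊆ zon l := by
  intro p hp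
  by_contra hpz
  obtain ⟨f, u, h1, h2⟩ := geometric_hahn_banach_point_closed (zon_convex l)
    (zon_compact l).isClosed hpz
  set w := (InnerProductSpace.toDual ℝ Plane).symm f with hw
  have hf : ∀ x, f x = inner ℝ w x := by
    intro x; simp [hw]
  obtain ⟨z, hz, h3⟩ := zon_lower l w
  have h4 := h2 z hz
  rw [hf] at h1 h4
  rw [mem_closedBall, dist_eq_norm] at hp
  have h5 := abs_real_inner_le_norm w (p - (1/2 : ℝ) • l.sum)
  rw [inner_sub_right, inner_smul_right] at h5
  have h6 := (abs_le.1 h5).1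
  have h7 := mul_le_mul_of_nonneg_left hp (norm_nonneg w)
  have h8 := h w
  linarith

/-- Unit vector of direction `θ`. -/
noncomputable def dir (θ : ℝ) : Plane := !₂[Real.cos θ, Real.sin θ]

/-- Equidistributed directions. -/
noncomputable def zl (r a : ℝ) (n : ℕ) : List Plane :=
  (List.range n).map fun k : ℕ => (r * (Real.pi / n)) • dir (a + Real.pi * k / n)

lemma list_range_sum (f : ℕ → ℝ) (n : ℕ) :
    ((List.range n).map f).sum = ∑ k ∈ Finset.range n, f k := by
  rw [Finset.sum_range]
  simp [← List.sum_ofFn, List.ofFn_eq_map, ← List.map_coe_finRange_eq_range, Function.comp_def]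

lemma inner_dir (w : Plane) : ∃ θ : ℝ, ∀ τ, inner ℝ w (dir τ) = ‖w‖ * Real.cos (τ - θ) := by
  let c : ℂ := ⟨w 0, w 1⟩
  have hc : ‖c‖ = ‖w‖ := by
    rw [EuclideanSpace.norm_eq, Complex.norm_eq_sqrt_sq_add_sq]
    simp [c]
  refine ⟨c.arg, fun τ => ?_⟩
  have h0 : w 0 = ‖w‖ * Real.cos c.arg := by rw [← hc, Complex.norm_mul_cos_arg]
  have h1 : w 1 = ‖w‖ * Real.sin c.arg := by rw [← hc, Complex.norm_mul_sin_arg]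
  rw [Real.cos_sub]
  simp only [PiLp.inner_apply, Fin.sum_univ_two, dir]
  simp [h0, h1]
  ring

lemma zl_support (r a : ℝ) (hr : 0 ≤ r) (n : ℕ) (hn : 0 < n) (w : Plane) :
    |((zl r a n).map fun v => |inner ℝ w v|).sum / 2 - r * ‖w‖| ≤
      r * ‖w‖ * (Real.pi ^ 2 / (2 * n)) := by
  obtain ⟨θ, hθ⟩ := inner_dir w
  have h := riemann (a - θ) n hn
  have e : ((zl r a n).map fun v => |inner ℝ w v|).sum = r * ‖w‖ * (Real.pi / n *
      ∑ k ∈ Finset.range n, |Real.cos (a - θ + Real.pi * k / n)|) := by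
    rw [zl, List.map_map, list_range_sum, Finset.mul_sum, Finset.mul_sum]
    refine Finset.sum_congr rfl fun k _ => ?_
    have : a - θ + Real.pi * k / n = a + Real.pi * k / n - θ := by ring
    simp only [Function.comp, inner_smul_right, hθ, abs_mul, this, abs_of_nonneg hr, abs_norm]
    rw [abs_of_nonneg (by positivity : 0 ≤ Real.pi / (n:ℝ))]
    ring
  rw [e]
  set S := Real.pi / n * ∑ k ∈ Finset.range n, |Real.cos (a - θ + Real.pi * k / n)|
  have : r * ‖w‖ * S / 2 - r * ‖w‖ = r * ‖w‖ * ((S - 2) / 2) := by ring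
  rw [this, abs_mul, abs_of_nonneg (by positivity : 0 ≤ r * ‖w‖)]
  apply mul_le_mul_of_nonneg_left _ (by positivity)
  rw [abs_div, abs_two]
  have e2 : Real.pi ^ 2 / (2 * n) = Real.pi ^ 2 / n / 2 := by ring
  rw [e2]
  linarith

lemma det2_smul_dir (b c θ φ : ℝ) : det2 (b • dir θ) (c • dir φ) = b * c * Real.sin (φ - θ) := by
  rw [Real.sin_sub]
  simp [det2, dir]
  ring

lemma zl_det_sum (b c : ℝ) (hb : 0 ≤ b) (hc : 0 ≤ c) (a a' : ℝ) (n : ℕ) (hn : 0 < n) :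
    ((zl b a n).map fun s => ((zl c a' n).map fun t => |det2 s t|).sum).sum ≤
      Real.pi * b * c * (2 + Real.pi ^ 2 / n) := by
  have hn' : (0:ℝ) < n := by exact_mod_cast hn
  have hz : zl b a n = (List.range n).map fun k : ℕ =>
    (b * (Real.pi / n)) • dir (a + Real.pi * k / n) := rfl
  rw [hz, List.map_map, list_range_sum]
  have h : ∀ i ∈ Finset.range n, ((fun s => ((zl c a' n).map fun t => |det2 s t|).sum) ∘
      fun k : ℕ => (b * (Real.pi / n)) • dir (a + Real.pi * k / n)) i ≤
      b * c * (Real.pi / n) * (2 + Real.pi ^ 2 / n) := by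
    intro i _
    have h := riemann (a' - (a + Real.pi * i / n) - Real.pi / 2) n hn
    have h' := sub_le_iff_le_add'.1 (abs_le.1 h).2
    simp only [Function.comp]
    rw [zl, List.map_map, list_range_sum]
    refine le_trans (le_of_eq ?_) (mul_le_mul_of_nonneg_left h' (by positivity))
    rw [Finset.mul_sum, Finset.mul_sum]
    refine Finset.sum_congr rfl fun j _ => ?_
    simp only [Function.comp]
    rw [det2_smul_dir]
    have e : a' - (a + Real.pi * i / n) - Real.pi / 2 + Real.pi * j / n =
      (a' + Real.pi * j / n - (a + Real.pi * i / n)) - Real.pi / 2 := by ring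
    rw [e, Real.cos_sub_pi_div_two, abs_mul, abs_of_nonneg (by positivity)]
    ring
  refine (Finset.sum_le_sum h).trans (le_of_eq ?_)
  simp only [Finset.sum_const, Finset.card_range, nsmul_eq_mul]
  field_simp

lemma zl_det_ne (b c : ℝ) (hb : 0 < b) (hc : 0 < c) (n : ℕ) (hn : 0 < n) :
    ∀ s ∈ zl b 0 n, ∀ t ∈ zl c (Real.pi / (2 * n)) n, det2 s t ≠ 0 := by
  have hn' : (0:ℝ) < n := by exact_mod_cast hn
  intro s hs t ht
  obtain ⟨i, _, rfl⟩ := List.mem_map.1 hs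
  obtain ⟨j, _, rfl⟩ := List.mem_map.1 ht
  rw [det2_smul_dir]
  apply mul_ne_zero (by have := Real.pi_pos; positivity)
  intro h
  obtain ⟨m, hm⟩ := Real.sin_eq_zero_iff.1 h
  have hp := Real.pi_pos
  have : (2 * n * m : ℝ) = 1 + 2 * j - 2 * i := by
    have := mul_left_cancel₀ hp.ne' (b := (m:ℝ)) (c := 1 / (2 * n) + j / n - i / n)
      (by rw [mul_comm, hm]; ring)
    rw [this]; field_simp
  have h2 : 2 * (n:ℤ) * m = 1 + 2 * j - 2 * i := by exact_mod_cast this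
  have h3 : 2 * (n * m - j + i : ℤ) = 1 := by linarith
  omega

lemma area_add_closedBall (A : Set Plane) (hA : IsCompact A) (δ : ℝ) (hδ : 0 ≤ δ) (x : Plane) :
    area (A + closedBall x δ) = area (cthickening δ A) := by
  rw [hA.add_closedBall hδ x]
  unfold area
  rw [measure_vadd]

lemma approx_ineq (A : Set Plane) (hA : IsCompact A) (hc : IsConnected A) (b c : ℝ) (hb : 0 < b)
    (hc0 : 0 < c) (n : ℕ) (hn : 0 < n) (η : ℝ) (hη : η = Real.pi ^ 2 / (2 * n)) (hη1 : η < 1) :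
    area (cthickening ((1 - η) * b + (1 - η) * c) A) + area A ≤
      area (cthickening ((1 + η) * b) A) + area (cthickening ((1 + η) * c) A) +
        2 * Real.pi * b * c * (1 + η) := by
  have hη0 : 0 ≤ η := by rw [hη]; positivity
  have hup : ∀ r a : ℝ, 0 < r → zon (zl r a n) ⊆
      closedBall ((1/2 : ℝ) • (zl r a n).sum) ((1 + η) * r) := by
    intro r a hr
    apply zon_subset_ball
    intro w
    have := (abs_le.1 (zl_support r a hr.le n hn w)).2
    rw [← hη] at this
    linarith
  have hlo : ∀ r a : ℝ, 0 < r → closedBall ((1/2 : ℝ) • (zl r a n).sum) ((1 - η) * r) ⊆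
      zon (zl r a n) := by
    intro r a hr
    apply ball_subset_zon
    intro w
    have := (abs_le.1 (zl_support r a hr.le n hn w)).1
    rw [← hη] at this
    linarith
  have key := zon_ineq _ _ (zl_det_ne b c hb hc0 n hn) A hA hc
  have hd := zl_det_sum b c hb.le hc0.le 0 (Real.pi / (2 * n)) n hn
  have e : 2 + Real.pi ^ 2 / n = 2 * (1 + η) := by rw [hη]; field_simp
  rw [e] at hd
  set k := zl b 0 n
  set l := zl c (Real.pi / (2 * n)) n
  have h1 : area (A + zon k) ≤ area (cthickening ((1 + η) * b) A) := by
    rw [← area_add_closedBall A hA _ (by positivity) ((1/2 : ℝ) • k.sum)]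
    exact area_mono (hA.add (isCompact_closedBall _ _)) (add_subset_add_left (hup b 0 hb))
  have h2 : area (A + zon l) ≤ area (cthickening ((1 + η) * c) A) := by
    rw [← area_add_closedBall A hA _ (by positivity) ((1/2 : ℝ) • l.sum)]
    exact area_mono (hA.add (isCompact_closedBall _ _)) (add_subset_add_left (hup c _ hc0))
  have p1 : 0 ≤ (1 - η) * b := mul_nonneg (by linarith) hb.le
  have p2 : 0 ≤ (1 - η) * c := mul_nonneg (by linarith) hc0.le
  have h3 : area (cthickening ((1 - η) * b + (1 - η) * c) A) ≤ area (A + zon k + zon l) := by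
    rw [← area_add_closedBall A hA _ (by positivity) ((1/2 : ℝ) • k.sum + (1/2 : ℝ) • l.sum),
      ← closedBall_add_closedBall p1 p2, ← add_assoc]
    exact area_mono ((hA.add (zon_compact k)).add (zon_compact l))
      (add_subset_add (add_subset_add_left (hlo b 0 hb)) (hlo c _ hc0))
  linarith

open Filter Topology in
lemma add_ineq (A : Set Plane) (hA : IsCompact A) (hc : IsConnected A) (b c : ℝ) (hb : 0 < b)
    (hc0 : 0 < c) :
    area (cthickening (b + c) A) + area A ≤
      area (cthickening b A) + area (cthickening c A) + 2 * Real.pi * b * c := by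
  let η : ℕ → ℝ := fun n => Real.pi ^ 2 / (2 * n)
  have hη : Tendsto η atTop (𝓝 0) := by
    have := tendsto_const_div_atTop_nhds_zero_nat (Real.pi ^ 2 / 2)
    refine this.congr fun n => ?_
    simp only [η]
    rw [div_div]
  have hη0 : ∀ n, 0 ≤ η n := fun n => by simp only [η]; positivity
  have hinv : Tendsto (fun n => (1 - η n)⁻¹) atTop (𝓝 1) := by
    have := (tendsto_const_nhds (x := (1:ℝ))).sub hη |>.inv₀ (by norm_num)
    simpa using this
  have hβ : Tendsto (fun n => (1 + η n) * (1 - η n)⁻¹) atTop (𝓝 1) := by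
    have := ((tendsto_const_nhds (x := (1:ℝ))).add hη).mul hinv
    simpa using this
  have hlim : ∀ b : ℝ, 0 < b → Tendsto (fun n => area (cthickening
      (((1 + η n) * (1 - η n)⁻¹ - 1) * b) (cthickening b A))) atTop (𝓝 (area (cthickening b A))) := by
    intro b hb
    have h1 := tendsto_measure_cthickening_of_isCompact (μ := (volume : Measure Plane))
      (hA.cthickening (r := b))
    have h2 : Tendsto (fun n => ((1 + η n) * (1 - η n)⁻¹ - 1) * b) atTop (𝓝 0) := by
      have := (hβ.sub_const 1).mul_const b
      simpa using this
    exact (ENNReal.tendsto_toReal (hA.cthickening (r := b)).measure_ne_top).comp (h1.comp h2)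
  have hlim2 : Tendsto (fun n => 2 * Real.pi * b * c * ((1 - η n)⁻¹ * (1 - η n)⁻¹ * (1 + η n)))
      atTop (𝓝 (2 * Real.pi * b * c)) := by
    have := ((hinv.mul hinv).mul ((tendsto_const_nhds (x := (1:ℝ))).add hη)).const_mul
      (2 * Real.pi * b * c)
    simpa using this
  refine ge_of_tendsto (((hlim b hb).add (hlim c hc0)).add hlim2) ?_
  filter_upwards [hη.eventually (gt_mem_nhds (zero_lt_one)), eventually_gt_atTop 0] with n h1 h2
  have hpos : 0 < 1 - η n := by linarith
  have h0 := hη0 n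
  have hg : 0 ≤ (1 + η n) * (1 - η n)⁻¹ - 1 := by
    have : (1 + η n) * (1 - η n)⁻¹ - 1 = 2 * η n * (1 - η n)⁻¹ := by field_simp; ring
    rw [this]; positivity
  have key := approx_ineq A hA hc ((1 - η n)⁻¹ * b) ((1 - η n)⁻¹ * c) (by positivity)
    (by positivity) n h2 (η n) rfl h1
  rw [mul_inv_cancel_left₀ hpos.ne', mul_inv_cancel_left₀ hpos.ne'] at key
  rw [cthickening_cthickening (by positivity) hb.le, cthickening_cthickening (by positivity) hc0.le]
  have e1 : ∀ b : ℝ, ((1 + η n) * (1 - η n)⁻¹ - 1) * b + b = (1 + η n) * ((1 - η n)⁻¹ * b) := by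
    intro b; ring
  rw [e1, e1]
  linarith

lemma thick_ineq (K : Set Plane) (hK : IsCompact K) (hc : IsConnected K) (a b c : ℝ) (ha : 0 ≤ a)
    (hb : 0 < b) (hc0 : 0 < c) :
    area (cthickening (a + b + c) K) + area (cthickening a K) ≤
      area (cthickening (a + b) K) + area (cthickening (a + c) K) + 2 * Real.pi * b * c := by
  have hcon : IsConnected (cthickening a K) := by
    rw [← hK.add_closedBall_zero ha]
    exact conn_add hc ((convex_closedBall _ _).isConnected ⟨0, by simp [ha]⟩)
  have h := add_ineq (cthickening a K) hK.cthickening hcon b c hb hc0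
  rw [cthickening_cthickening (by positivity) ha, cthickening_cthickening hb.le ha,
    cthickening_cthickening hc0.le ha] at h
  rw [show a + b + c = b + c + a by ring, add_comm a b, add_comm a c]
  exact h

lemma concave_seq (u : ℕ → ℝ) (h0 : u 0 = 0) (h : ∀ k, u (k + 2) + u k ≤ 2 * u (k + 1))
    (p q : ℕ) (hp : 0 < p) (hpq : p ≤ q) : p * u q ≤ q * u p := by
  have h1 : ∀ k : ℕ, (k : ℝ) * u (k + 1) ≤ (k + 1) * u k := by
    intro k
    induction k with
    | zero => simp [h0]
    | succ k ih =>
      have := mul_le_mul_of_nonneg_left (h k) (by positivity : (0:ℝ) ≤ k + 1)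
      push_cast
      linarith
  induction q, hpq using Nat.le_induction with
  | base => exact le_rfl
  | succ q hq ih =>
    have hq0 : (0:ℝ) < q := by exact_mod_cast lt_of_lt_of_le hp hq
    have h2 := mul_le_mul_of_nonneg_left (h1 q) (by positivity : (0:ℝ) ≤ p)
    have h3 := mul_le_mul_of_nonneg_left ih (by positivity : (0:ℝ) ≤ q + 1)
    refine le_of_mul_le_mul_left ?_ hq0
    push_cast
    linarith

open Filter Topology in
/-- For a nonempty compact connected `K ⊆ ℝ²`, the function
`ε ↦ L(K^ε \ K)/ε − πε` is non-increasing on `(0, ∞)`. -/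
theorem stmt_2 (K : Set Plane) (hK : IsCompact K) (hKconn : IsConnected K) :
    AntitoneOn (fun ε : ℝ => (volume (cthickening ε K \ K)).toReal / ε - Real.pi * ε)
      (Set.Ioi 0) := by
  intro r hr R _ hrR
  have hr : 0 < r := hr
  have hR : 0 < R := lt_of_lt_of_le hr hrR
  have hdiff : ∀ ε, (volume (cthickening ε K \ K)).toReal = area (cthickening ε K) - area K := by
    intro ε
    rw [measure_sdiff (self_subset_cthickening K) hK.measurableSet.nullMeasurableSet
      hK.measure_ne_top, ENNReal.toReal_sub_of_le (measure_mono (self_subset_cthickening K))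
      hK.cthickening.measure_ne_top]
    rfl
  have hfrac : ∀ n : ℕ, 0 < n → area (cthickening R K) - area K ≤
      (⌈R / r * n⌉₊ / n : ℝ) * (area (cthickening r K) - area K - Real.pi * r ^ 2) +
        Real.pi * ((⌈R / r * n⌉₊ / n : ℝ) * r) ^ 2 := by
    intro n hn
    have hn' : (0:ℝ) < n := by exact_mod_cast hn
    set q := ⌈R / r * n⌉₊ with hq
    have hqR : R / r * n ≤ q := Nat.le_ceil _
    have hnq : n ≤ q := by
      have h1 : 1 ≤ R / r := (one_le_div hr).2 hrR
      have : (n:ℝ) ≤ q := by nlinarith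
      exact_mod_cast this
    let h := r / n
    have hh : 0 < h := by positivity
    let u : ℕ → ℝ := fun k => area (cthickening (k * h) K) - area K - Real.pi * (k * h) ^ 2
    have key := concave_seq u ?_ ?_ n q hn hnq
    · have e1 : (n:ℝ) * h = r := by simp only [h]; field_simp
      have e2 : (q:ℝ) * h = q / n * r := by simp only [h]; field_simp
      simp only [u, e1] at key
      rw [e2] at key
      have hmono : area (cthickening R K) ≤ area (cthickening (q / n * r) K) := by
        apply area_mono hK.cthickening
        apply cthickening_mono
        rw [div_mul_eq_mul_div, le_div_iff₀ hn']
        have : R / r * n * r ≤ q * r := mul_le_mul_of_nonneg_right hqR hr.le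
        have e : R / r * n * r = R * n := by field_simp
        linarith
      have : area (cthickening (q / n * r) K) - area K - Real.pi * (q / n * r) ^ 2 ≤
          q / n * (area (cthickening r K) - area K - Real.pi * r ^ 2) := by
        refine le_of_mul_le_mul_left (key.trans (le_of_eq ?_)) hn'
        field_simp
      linarith
    · simp [u, cthickening_zero, hK.isClosed.closure_eq]
    · intro k
      have := thick_ineq K hK hKconn (k * h) h h (by positivity) hh hh
      simp only [u]
      push_cast
      rw [show ((k:ℝ) + 2) * h = k * h + h + h by ring, show ((k:ℝ) + 1) * h = k * h + h by ring]
      linarith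
  have hlim : Tendsto (fun n : ℕ => (⌈R / r * n⌉₊ / n : ℝ)) atTop (𝓝 (R / r)) :=
    (tendsto_nat_ceil_mul_div_atTop (by positivity)).comp tendsto_natCast_atTop_atTop
  have hfin := ge_of_tendsto ((hlim.mul_const
    (area (cthickening r K) - area K - Real.pi * r ^ 2)).add
    (((hlim.mul_const r).pow 2).const_mul Real.pi))
    ((eventually_gt_atTop 0).mono hfrac)
  rw [div_mul_cancel₀ _ hr.ne'] at hfin
  simp only [hdiff]
  have e1 : (area (cthickening R K) - area K) / R - Real.pi * R =
      (area (cthickening R K) - area K - Real.pi * R ^ 2) / R := by field_simp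
  have e2 : (area (cthickening r K) - area K) / r - Real.pi * r =
      (area (cthickening r K) - area K - Real.pi * r ^ 2) / r := by field_simp
  rw [e1, e2, div_le_iff₀ hR]
  have e3 : (area (cthickening r K) - area K - Real.pi * r ^ 2) / r * R =
    R / r * (area (cthickening r K) - area K - Real.pi * r ^ 2) := by ring
  rw [e3]
  linarith
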